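/- arXiv:1304.1250 — 11 statements merged into one kernel-verified Lean document; each statement's English description precedes it below -/
import Mathlib

section
/- Let d n be natural numbers, let a : Fin n → EuclideanSpace ℝ (Fin d) and y : Fin n → ℝ, and for each i let f i (β) = (⟪a i, β⟫ - y i)^2. Let I be a nonempty finite subset of Fin n and suppose β* minimizes β ↦ max_{i ∈ I} f i (β), with optimal value δ_opt = max_{i ∈ I} f i (β*). If i₀ ∈ I satisfies f i₀ (β*) < δ_opt, then removing i₀ does not decrease the optimal residual: for every β, max_{i ∈ I \ {i₀}} f i (β) ≥ δ_opt, and max_{i ∈ I \ {i₀}} f i (β*) = δ_opt; in particular the infimum over β of max_{i ∈ I \ {i₀}} f i (β) equals δ_opt. -/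
open RealInnerProductSpace

/-- If a point minimizes the maximum of finitely many convex functions and the function `f i₀` is
strictly below the optimal value there, then every point still has some other function at or above
the optimal value. -/
theorem exists_mem_erase_le_of_convexOn {ι E : Type*} [DecidableEq ι] [AddCommGroup E] [Module ℝ E]
    {f : ι → E → ℝ} {I : Finset ι} {x : E} {δ : ℝ} {i₀ : ι}
    (hf : ∀ i ∈ I, ConvexOn ℝ Set.univ (f i)) (hi₀ : i₀ ∈ I)
    (hle : ∀ i ∈ I, f i x ≤ δ) (hmin : ∀ z, ∃ i ∈ I, δ ≤ f i z) (hlt : f i₀ x < δ) (z : E) :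
    ∃ i ∈ I.erase i₀, δ ≤ f i z := by
  by_contra! hz
  obtain ⟨c, hc, hcδ⟩ := exists_pos_mul_lt (sub_pos.2 hlt) |f i₀ z - f i₀ x|
  obtain ⟨t, ht, htc, ht1⟩ : ∃ t : ℝ, 0 < t ∧ t ≤ c ∧ t ≤ 1 :=
    ⟨min c 1, lt_min hc one_pos, min_le_left _ _, min_le_right _ _⟩
  obtain ⟨i, hi, hδi⟩ := hmin ((1 - t) • x + t • z)
  have hconv := (hf i hi).2 (Set.mem_univ x) (Set.mem_univ z) (sub_nonneg.2 ht1) ht.le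
    (sub_add_cancel 1 t)
  simp only [smul_eq_mul] at hconv
  by_cases h : i = i₀
  · subst h
    have h1 : t * (f i z - f i x) ≤ t * |f i z - f i x| :=
      mul_le_mul_of_nonneg_left (le_abs_self _) ht.le
    have h2 : t * |f i z - f i x| ≤ c * |f i z - f i x| :=
      mul_le_mul_of_nonneg_right htc (abs_nonneg _)
    linarith
  · have h1 := mul_le_mul_of_nonneg_left (hle i hi) (sub_nonneg.2 ht1)
    have h2 := mul_lt_mul_of_pos_left (hz i (Finset.mem_erase.2 ⟨h, hi⟩)) ht
    linarith

/-- A squared affine residual is convex. -/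
theorem convexOn_inner_sub_sq {E : Type*} [NormedAddCommGroup E] [InnerProductSpace ℝ E]
    (v : E) (r : ℝ) : ConvexOn ℝ Set.univ fun x : E => (⟪v, x⟫ - r) ^ 2 := by
  refine ⟨convex_univ, fun x _ z _ p q hp hq hpq => ?_⟩
  obtain rfl : q = 1 - p := by linarith
  simp only [inner_add_right, inner_smul_right, smul_eq_mul]
  nlinarith [mul_nonneg (mul_nonneg hp hq) (sq_nonneg (⟪v, x⟫ - ⟪v, z⟫))]

/-- Removing a measurement `i₀` that is not in the support set of the
`L∞` minimax problem with squared residuals does not decrease the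
optimal residual. -/
theorem linf_remove_non_support_sq
    (d n : ℕ) (a : Fin n → EuclideanSpace ℝ (Fin d)) (y : Fin n → ℝ)
    (f : Fin n → EuclideanSpace ℝ (Fin d) → ℝ)
    (hf : ∀ i β, f i β = (⟪a i, β⟫ - y i) ^ 2)
    (I : Finset (Fin n)) (hI : I.Nonempty)
    (βstar : EuclideanSpace ℝ (Fin d))
    (hmin : ∀ β, I.sup' hI (fun i => f i βstar) ≤ I.sup' hI (fun i => f i β))
    (δopt : ℝ) (hδ : δopt = I.sup' hI (fun i => f i βstar))
    (i₀ : Fin n) (hi₀ : i₀ ∈ I) (hlt : f i₀ βstar < δopt)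
    (hne : (I.erase i₀).Nonempty) :
    (∀ β, δopt ≤ (I.erase i₀).sup' hne (fun i => f i β)) ∧
    (I.erase i₀).sup' hne (fun i => f i βstar) = δopt ∧
    (⨅ β : EuclideanSpace ℝ (Fin d), (I.erase i₀).sup' hne (fun i => f i β)) = δopt := by
  have hle : ∀ i ∈ I, f i βstar ≤ δopt := fun i hi =>
    hδ ▸ Finset.le_sup' (fun i => f i βstar) hi
  have hlower : ∀ β, δopt ≤ (I.erase i₀).sup' hne (fun i => f i β) := fun β =>
    (Finset.le_sup'_iff hne).2 <| exists_mem_erase_le_of_convexOn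
      (fun i _ => (funext (hf i) : f i = _) ▸ convexOn_inner_sub_sq (a i) (y i)) hi₀ hle
      (fun z => (Finset.le_sup'_iff hI).1 (hδ ▸ hmin z)) hlt β
  have heq : (I.erase i₀).sup' hne (fun i => f i βstar) = δopt :=
    le_antisymm (Finset.sup'_le hne _ fun i hi => hle i (Finset.mem_of_mem_erase hi))
      (hlower βstar)
  exact ⟨hlower, heq, le_antisymm
    (heq ▸ ciInf_le ⟨δopt, Set.forall_mem_range.2 hlower⟩ βstar) (le_ciInf hlower)⟩
end

section
/- Let d n be natural numbers, let a : Fin n → EuclideanSpace ℝ (Fin d) and y : Fin n → ℝ, and for each i let g i (β) = |⟪a i, β⟫ - y i|. Let I be a nonempty finite subset of Fin n and suppose β* minimizes β ↦ max_{i ∈ I} g i (β), with optimal value δ_opt = max_{i ∈ I} g i (β*). If i₀ ∈ I satisfies g i₀ (β*) < δ_opt, then for every β, max_{i ∈ I \ {i₀}} g i (β) ≥ δ_opt, and max_{i ∈ I \ {i₀}} g i (β*) = δ_opt; in particular the infimum over β of max_{i ∈ I \ {i₀}} g i (β) equals δ_opt. -/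
open RealInnerProductSpace

/-- Absolute residuals of affine measurements are convex along segments. -/
theorem abs_inner_sub_segment_le {E : Type*} [NormedAddCommGroup E] [InnerProductSpace ℝ E]
    (a x z : E) (y : ℝ) {t : ℝ} (ht0 : 0 ≤ t) (ht1 : t ≤ 1) :
    |⟪a, (1 - t) • x + t • z⟫ - y| ≤ (1 - t) * |⟪a, x⟫ - y| + t * |⟪a, z⟫ - y| := by
  have h : ⟪a, (1 - t) • x + t • z⟫ - y = (1 - t) * (⟪a, x⟫ - y) + t * (⟪a, z⟫ - y) := by
    rw [inner_add_right, real_inner_smul_right, real_inner_smul_right]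
    ring
  rw [h]
  refine (abs_add_le _ _).trans_eq ?_
  rw [abs_mul, abs_mul, abs_of_nonneg ht0, abs_of_nonneg (sub_nonneg.2 ht1)]

/-- Removing a measurement `i₀` that is not in the support set of the
`L∞` minimax problem with absolute residuals does not decrease the
optimal residual. -/
theorem linf_remove_non_support_abs
    (d n : ℕ) (a : Fin n → EuclideanSpace ℝ (Fin d)) (y : Fin n → ℝ)
    (g : Fin n → EuclideanSpace ℝ (Fin d) → ℝ)
    (hg : ∀ i β, g i β = |⟪a i, β⟫ - y i|)
    (I : Finset (Fin n)) (hI : I.Nonempty)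
    (βstar : EuclideanSpace ℝ (Fin d))
    (hmin : ∀ β, I.sup' hI (fun i => g i βstar) ≤ I.sup' hI (fun i => g i β))
    (δopt : ℝ) (hδ : δopt = I.sup' hI (fun i => g i βstar))
    (i₀ : Fin n) (hi₀ : i₀ ∈ I) (hlt : g i₀ βstar < δopt)
    (hne : (I.erase i₀).Nonempty) :
    (∀ β, δopt ≤ (I.erase i₀).sup' hne (fun i => g i β)) ∧
    (I.erase i₀).sup' hne (fun i => g i βstar) = δopt ∧
    (⨅ β : EuclideanSpace ℝ (Fin d), (I.erase i₀).sup' hne (fun i => g i β)) = δopt := by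
  have hle (i) (hi : i ∈ I) : g i βstar ≤ δopt :=
    hδ ▸ Finset.le_sup' (fun i => g i βstar) hi
  have hlower (β) : δopt ≤ (I.erase i₀).sup' hne (fun i => g i β) := by
    by_contra! hβ
    rw [Finset.sup'_lt_iff] at hβ
    have hc : 0 ≤ g i₀ βstar := by rw [hg]; exact abs_nonneg _
    have he : 0 ≤ g i₀ β := by rw [hg]; exact abs_nonneg _
    -- A small step from `βstar` towards `β` keeps the residual at `i₀` below `δopt`.
    obtain ⟨t, ht0, ht1, hti⟩ : ∃ t : ℝ, 0 < t ∧ t ≤ 1 ∧ t * g i₀ β < δopt - g i₀ βstar := by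
      have hpos : 0 < δopt - g i₀ βstar := sub_pos.2 hlt
      have hden : 0 < δopt - g i₀ βstar + g i₀ β + 1 := by linarith
      refine ⟨(δopt - g i₀ βstar) / (δopt - g i₀ βstar + g i₀ β + 1), by positivity, ?_, ?_⟩
      · rw [div_le_one hden]
        linarith
      · rw [div_mul_eq_mul_div, div_lt_iff₀ hden]
        exact mul_lt_mul_of_pos_left (by linarith) hpos
    refine (hmin ((1 - t) • βstar + t • β)).not_gt ?_
    rw [← hδ, Finset.sup'_lt_iff]
    intro i hi
    have hconv : g i ((1 - t) • βstar + t • β) ≤ (1 - t) * g i βstar + t * g i β := by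
      simp only [hg]
      exact abs_inner_sub_segment_le _ _ _ _ ht0.le ht1
    refine hconv.trans_lt ?_
    by_cases h : i = i₀
    · subst h
      nlinarith [mul_nonneg ht0.le hc]
    · have h₁ := mul_le_mul_of_nonneg_left (hle i hi) (sub_nonneg.2 ht1)
      have h₂ := mul_lt_mul_of_pos_left (hβ i (Finset.mem_erase.2 ⟨h, hi⟩)) ht0
      linarith
  have heq : (I.erase i₀).sup' hne (fun i => g i βstar) = δopt :=
    le_antisymm (Finset.sup'_le _ _ fun i hi => hle i (Finset.mem_of_mem_erase hi))
      (hlower βstar)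
  refine ⟨hlower, heq, le_antisymm ?_ (le_ciInf hlower)⟩
  exact (ciInf_le ⟨δopt, Set.forall_mem_range.2 hlower⟩ βstar).trans_eq heq
end

section
/- Let E be a real normed vector space, let n be a natural number, and let f : Fin n → E → ℝ be a family of functions such that each f i is convex on all of E (ConvexOn ℝ Set.univ (f i)) and continuous. Let I be a nonempty finite subset of Fin n and suppose β* minimizes β ↦ max_{i ∈ I} f i (β), with optimal value δ_opt = max_{i ∈ I} f i (β*). If i₀ ∈ I satisfies f i₀ (β*) < δ_opt, then for every β, max_{i ∈ I \ {i₀}} f i (β) ≥ δ_opt; that is, removing the measurement i₀, which is not in the support set, does not decrease the optimal minimax residual. -/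
/-- For a family of continuous convex residual functions, removing a
measurement `i₀` that is not in the support set of the minimax problem
does not decrease the optimal minimax residual. -/
theorem minimax_remove_non_support_convex
    (E : Type*) [NormedAddCommGroup E] [NormedSpace ℝ E]
    (n : ℕ) (f : Fin n → E → ℝ)
    (hconv : ∀ i, ConvexOn ℝ Set.univ (f i))
    (hcont : ∀ i, Continuous (f i))
    (I : Finset (Fin n)) (hI : I.Nonempty)
    (βstar : E)
    (hmin : ∀ β, I.sup' hI (fun i => f i βstar) ≤ I.sup' hI (fun i => f i β))
    (δopt : ℝ) (hδ : δopt = I.sup' hI (fun i => f i βstar))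
    (i₀ : Fin n) (hi₀ : i₀ ∈ I) (hlt : f i₀ βstar < δopt)
    (hne : (I.erase i₀).Nonempty) :
    ∀ β, δopt ≤ (I.erase i₀).sup' hne (fun i => f i β) := by
  intro β
  by_contra! hβ
  rw [Finset.sup'_lt_iff] at hβ
  have hseg : Continuous fun t : ℝ => f i₀ ((1 - t) • βstar + t • β) :=
    (hcont i₀).comp (by fun_prop)
  have hnear : ∀ᶠ t in nhds (0 : ℝ), f i₀ ((1 - t) • βstar + t • β) < δopt :=
    hseg.continuousAt.eventually_lt continuousAt_const (by simpa using hlt)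
  obtain ⟨t, ht, ht0, ht1⟩ := ((hnear.filter_mono nhdsWithin_le_nhds).and
    (Ioo_mem_nhdsGT (zero_lt_one' ℝ))).exists
  refine absurd (hmin ((1 - t) • βstar + t • β)) (not_le.mpr ?_)
  rw [← hδ, Finset.sup'_lt_iff]
  intro i hi
  obtain rfl | hne_i := eq_or_ne i i₀
  · exact ht
  have hstar : f i βstar ≤ δopt := hδ ▸ Finset.le_sup' (fun i => f i βstar) hi
  have hlt_i : f i β < δopt := hβ i (Finset.mem_erase.mpr ⟨hne_i, hi⟩)
  have hcomb := (hconv i).2 (Set.mem_univ βstar) (Set.mem_univ β)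
    (sub_nonneg.mpr ht1.le) ht0.le (sub_add_cancel 1 t)
  simp only [smul_eq_mul] at hcomb
  nlinarith [mul_le_mul_of_nonneg_left hstar (sub_nonneg.mpr ht1.le),
    mul_lt_mul_of_pos_left hlt_i ht0]
end

section
/- Let E be a real normed vector space, let n be a natural number, and let f : Fin n → E → ℝ be a family of functions such that each f i is convex on all of E (ConvexOn ℝ Set.univ (f i)) and continuous. Let I be a nonempty finite subset of Fin n, let β* minimize β ↦ max_{i ∈ I} f i (β) with optimal value δ_opt, and let J ⊆ I be a subset such that f i (β*) < δ_opt for every i ∈ J. Then I \ J is nonempty and for every β, max_{i ∈ I \ J} f i (β) ≥ δ_opt. -/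
/-- For continuous convex residual functions, simultaneously removing
any set `J` of measurements disjoint from the support set of the minimax
problem does not decrease the optimal minimax residual. -/
theorem minimax_remove_non_support_set_convex
    (E : Type*) [NormedAddCommGroup E] [NormedSpace ℝ E]
    (n : ℕ) (f : Fin n → E → ℝ)
    (hconv : ∀ i, ConvexOn ℝ Set.univ (f i))
    (hcont : ∀ i, Continuous (f i))
    (I : Finset (Fin n)) (hI : I.Nonempty)
    (βstar : E)
    (hmin : ∀ β, I.sup' hI (fun i => f i βstar) ≤ I.sup' hI (fun i => f i β))
    (δopt : ℝ) (hδ : δopt = I.sup' hI (fun i => f i βstar))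
    (J : Finset (Fin n)) (hJ : J ⊆ I) (hJlt : ∀ i ∈ J, f i βstar < δopt) :
    ∃ hne : (I \ J).Nonempty,
      ∀ β, δopt ≤ (I \ J).sup' hne (fun i => f i β) := by
  have hle : ∀ i ∈ I, f i βstar ≤ δopt := fun i hi =>
    hδ ▸ Finset.le_sup' (fun i => f i βstar) hi
  obtain ⟨k, hkI, hk⟩ := Finset.exists_mem_eq_sup' hI (fun i => f i βstar)
  have hkJ : k ∉ J := fun h => (hJlt k h).ne (hδ.trans hk).symm
  have hne : (I \ J).Nonempty := ⟨k, Finset.mem_sdiff.mpr ⟨hkI, hkJ⟩⟩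
  refine ⟨hne, fun β => ?_⟩
  by_contra! hlt
  replace hlt := (Finset.sup'_lt_iff hne).mp hlt
  have hev : ∀ i ∈ I, ∀ᶠ t : ℝ in nhdsWithin 0 (Set.Ioi 0),
      f i ((1 - t) • βstar + t • β) < δopt := by
    intro i hi
    by_cases hiJ : i ∈ J
    · have hc : Continuous fun t : ℝ => f i ((1 - t) • βstar + t • β) :=
        (hcont i).comp (by fun_prop)
      apply (hc.tendsto 0).mono_left nhdsWithin_le_nhds |>.eventually_lt_const
      simpa using hJlt i hiJ
    · filter_upwards [Ioo_mem_nhdsGT (zero_lt_one' ℝ)] with t ⟨ht0, ht1⟩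
      have hcx := (hconv i).2 (Set.mem_univ βstar) (Set.mem_univ β)
        (sub_nonneg.mpr ht1.le) ht0.le (sub_add_cancel 1 t)
      have hβ := hlt i (Finset.mem_sdiff.mpr ⟨hi, hiJ⟩)
      simp only [smul_eq_mul] at hcx
      nlinarith [mul_lt_mul_of_pos_left hβ ht0,
        mul_le_mul_of_nonneg_left (hle i hi) (sub_nonneg.mpr ht1.le)]
  obtain ⟨t, ht⟩ := ((Filter.eventually_all_finset I).mpr hev).exists
  exact (hmin _).not_gt (hδ ▸ (Finset.sup'_lt_iff hI).mpr ht)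
end

section
/- Let d n be natural numbers, let a : Fin n → EuclideanSpace ℝ (Fin d) and y : Fin n → ℝ, and for each i let f i (β) = (⟪a i, β⟫ - y i)^2. Let I be a nonempty finite subset of Fin n, let β* minimize β ↦ max_{i ∈ I} f i (β) with optimal value δ_opt, and let I_in ⊆ I be a nonempty subset (the inliers) such that there exists β_in with max_{i ∈ I_in} f i (β_in) < δ_opt. Then there exists an index i ∈ I \ I_in (an outlier) with f i (β*) = δ_opt; that is, the support set of the minimax problem contains at least one outlier. -/
open RealInnerProductSpace

open Filter Topology in
/-- If a minimizer `x` of the maximum of continuous convex functions has maximal value `δ`, and some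
point `z` makes all functions indexed by `J` smaller than `δ`, then a function indexed outside `J`
attains the value `δ` at `x`. -/
theorem exists_mem_sdiff_eq_sup'_of_convexOn {ι E : Type*} [DecidableEq ι] [AddCommGroup E]
    [Module ℝ E] [TopologicalSpace E] [ContinuousAdd E] [ContinuousSMul ℝ E]
    {f : ι → E → ℝ} {I J : Finset ι} (hI : I.Nonempty)
    (hconv : ∀ i ∈ I, ConvexOn ℝ Set.univ (f i)) (hcont : ∀ i ∈ I, Continuous (f i)) {x z : E}
    (hmin : ∀ w, I.sup' hI (fun i => f i x) ≤ I.sup' hI (fun i => f i w))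
    (hz : ∀ i ∈ J, f i z < I.sup' hI (fun i => f i x)) :
    ∃ i ∈ I \ J, f i x = I.sup' hI (fun i => f i x) := by
  by_contra! hne
  set δ := I.sup' hI (fun i => f i x) with hδ
  have hle : ∀ i ∈ I, f i x ≤ δ := fun i hi => Finset.le_sup' (fun i => f i x) hi
  have hdecrease : ∀ᶠ t : ℝ in 𝓝[>] 0, ∀ i ∈ I, f i ((1 - t) • x + t • z) < δ := by
    rw [Filter.eventually_all_finset]
    intro i hi
    by_cases hiJ : i ∈ J
    · filter_upwards [Ioo_mem_nhdsGT (zero_lt_one' ℝ)] with t ht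
      have hseg := (hconv i hi).2 (Set.mem_univ x) (Set.mem_univ z) (sub_nonneg.2 ht.2.le)
        ht.1.le (sub_add_cancel 1 t)
      simp only [smul_eq_mul] at hseg
      nlinarith [mul_lt_mul_of_pos_left (hz i hiJ) ht.1,
        mul_le_mul_of_nonneg_left (hle i hi) (sub_nonneg.2 ht.2.le)]
    · have hlt : f i x < δ := (hle i hi).lt_of_ne (hne i (Finset.mem_sdiff.2 ⟨hi, hiJ⟩))
      have hc : Continuous fun t : ℝ => f i ((1 - t) • x + t • z) :=
        (hcont i hi).comp (by fun_prop)
      have ht : Tendsto (fun t : ℝ => f i ((1 - t) • x + t • z)) (𝓝[>] 0) (𝓝 (f i x)) := by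
        simpa using (hc.tendsto 0).mono_left nhdsWithin_le_nhds
      exact ht.eventually_lt_const hlt
  obtain ⟨t, ht⟩ := hdecrease.exists
  exact (hmin _).not_gt ((Finset.sup'_lt_iff hI).2 ht)

theorem convexOn_inner_sub_const_sq {E : Type*} [NormedAddCommGroup E] [InnerProductSpace ℝ E]
    (a : E) (y : ℝ) : ConvexOn ℝ Set.univ (fun β : E => (⟪a, β⟫ - y) ^ 2) :=
  (even_two.convexOn_pow (𝕜 := ℝ)).comp_affineMap
    ((innerₛₗ ℝ a).toAffineMap - AffineMap.const ℝ E y)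

/-- If an inlier subset admits a strictly smaller minimax residual than the
optimal value `δopt` of the full `L∞` problem (squared residuals), then the
support set contains at least one outlier. -/
theorem linf_support_contains_outlier_sq
    (d n : ℕ) (a : Fin n → EuclideanSpace ℝ (Fin d)) (y : Fin n → ℝ)
    (f : Fin n → EuclideanSpace ℝ (Fin d) → ℝ)
    (hf : ∀ i β, f i β = (⟪a i, β⟫ - y i) ^ 2)
    (I : Finset (Fin n)) (hI : I.Nonempty)
    (βstar : EuclideanSpace ℝ (Fin d))
    (hmin : ∀ β, I.sup' hI (fun i => f i βstar) ≤ I.sup' hI (fun i => f i β))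
    (δopt : ℝ) (hδ : δopt = I.sup' hI (fun i => f i βstar))
    (Iin : Finset (Fin n)) (hsub : Iin ⊆ I) (hIin : Iin.Nonempty)
    (βin : EuclideanSpace ℝ (Fin d))
    (hin : Iin.sup' hIin (fun i => f i βin) < δopt) :
    ∃ i ∈ I \ Iin, f i βstar = δopt := by
  obtain rfl : f = fun i β => (⟪a i, β⟫ - y i) ^ 2 := by
    funext i β
    exact hf i β
  subst hδ
  exact exists_mem_sdiff_eq_sup'_of_convexOn hI
    (fun i _ => convexOn_inner_sub_const_sq (a i) (y i)) (fun i _ => by fun_prop) hmin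
    ((Finset.sup'_lt_iff hIin).1 hin)
end

section
/- Let d n be natural numbers, let a : Fin n → EuclideanSpace ℝ (Fin d) and y : Fin n → ℝ, and for each i let g i (β) = |⟪a i, β⟫ - y i|. Let I be a nonempty finite subset of Fin n, let β* minimize β ↦ max_{i ∈ I} g i (β) with optimal value δ_opt, and let I_in ⊆ I be a nonempty subset (the inliers) such that there exists β_in with max_{i ∈ I_in} g i (β_in) < δ_opt. Then there exists an index i ∈ I \ I_in (an outlier) with g i (β*) = δ_opt; that is, the support set of the minimax problem contains at least one outlier. -/
open RealInnerProductSpace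

open Filter Topology in
/-- A minimizer of a pointwise maximum of finitely many continuous convex functions is active at
some index outside any subfamily that can be made strictly smaller than the optimal value. -/
theorem exists_active_notMem_of_sup'_lt {ι E : Type*} [DecidableEq ι] [AddCommGroup E]
    [Module ℝ E] [TopologicalSpace E] [IsTopologicalAddGroup E] [ContinuousSMul ℝ E]
    {g : ι → E → ℝ} {I J : Finset ι} (hI : I.Nonempty) (hcont : ∀ i ∈ I, Continuous (g i))
    (hconv : ∀ i ∈ J, ConvexOn ℝ Set.univ (g i)) {x z : E}
    (hmin : ∀ w, I.sup' hI (fun i => g i x) ≤ I.sup' hI (fun i => g i w))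
    (hz : ∀ i ∈ J, g i z < I.sup' hI (fun i => g i x)) :
    ∃ i ∈ I \ J, g i x = I.sup' hI (fun i => g i x) := by
  by_contra! hne
  set δ := I.sup' hI (fun i => g i x) with hδ
  have hle : ∀ i ∈ I, g i x ≤ δ := fun i hi => Finset.le_sup' (fun i => g i x) hi
  have hev : ∀ i ∈ I, ∀ᶠ t : ℝ in 𝓝[>] 0, g i ((1 - t) • x + t • z) < δ := by
    intro i hi
    by_cases hiJ : i ∈ J
    · filter_upwards [Ioc_mem_nhdsGT (zero_lt_one' ℝ)] with t ht
      have h := (hconv i hiJ).2 (Set.mem_univ x) (Set.mem_univ z)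
        (sub_nonneg.2 ht.2) ht.1.le (sub_add_cancel 1 t)
      simp only [smul_eq_mul] at h
      nlinarith [mul_le_mul_of_nonneg_left (hle i hi) (sub_nonneg.2 ht.2),
        mul_lt_mul_of_pos_left (hz i hiJ) ht.1]
    · have hlt : g i x < δ := (hle i hi).lt_of_ne (hne i (Finset.mem_sdiff.2 ⟨hi, hiJ⟩))
      have hc : Continuous fun t : ℝ => g i ((1 - t) • x + t • z) :=
        (hcont i hi).comp (by fun_prop)
      refine nhdsWithin_le_nhds (hc.continuousAt.eventually_lt continuousAt_const ?_)
      simpa using hlt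
  obtain ⟨t, ht⟩ := ((Finset.eventually_all I).2 hev).exists
  exact (hmin ((1 - t) • x + t • z)).not_gt ((Finset.sup'_lt_iff hI).2 ht)

/-- The absolute residual of an affine functional is convex. -/
theorem convexOn_abs_inner_sub {E : Type*} [NormedAddCommGroup E] [InnerProductSpace ℝ E]
    (v : E) (c : ℝ) : ConvexOn ℝ Set.univ fun x => |⟪v, x⟫ - c| :=
  (((innerSL ℝ v).toLinearMap.convexOn convex_univ).sub (concaveOn_const c convex_univ)).sup
    ((convexOn_const c convex_univ).sub ((innerSL ℝ v).toLinearMap.concaveOn convex_univ))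
    |>.congr fun x _ => by simp [abs, sub_eq_add_neg]

/-- If an inlier subset admits a strictly smaller minimax residual than the
optimal value `δopt` of the full `L∞` problem (absolute residuals), then the
support set contains at least one outlier. -/
theorem linf_support_contains_outlier_abs
    (d n : ℕ) (a : Fin n → EuclideanSpace ℝ (Fin d)) (y : Fin n → ℝ)
    (g : Fin n → EuclideanSpace ℝ (Fin d) → ℝ)
    (hg : ∀ i β, g i β = |⟪a i, β⟫ - y i|)
    (I : Finset (Fin n)) (hI : I.Nonempty)
    (βstar : EuclideanSpace ℝ (Fin d))
    (hmin : ∀ β, I.sup' hI (fun i => g i βstar) ≤ I.sup' hI (fun i => g i β))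
    (δopt : ℝ) (hδ : δopt = I.sup' hI (fun i => g i βstar))
    (Iin : Finset (Fin n)) (hsub : Iin ⊆ I) (hIin : Iin.Nonempty)
    (βin : EuclideanSpace ℝ (Fin d))
    (hin : Iin.sup' hIin (fun i => g i βin) < δopt) :
    ∃ i ∈ I \ Iin, g i βstar = δopt := by
  subst hδ
  have hg' : ∀ i, g i = fun β => |⟪a i, β⟫ - y i| := fun i => funext (hg i)
  refine exists_active_notMem_of_sup'_lt hI (fun i _ => ?_) (fun i _ => ?_) hmin
    ((Finset.sup'_lt_iff hIin).1 hin)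
  · rw [hg' i]
    fun_prop
  · rw [hg' i]
    exact convexOn_abs_inner_sub (a i) (y i)
end

section
/- Let E be a real normed vector space, let n be a natural number, and let f : Fin n → E → ℝ be a family of functions such that each f i is convex on all of E (ConvexOn ℝ Set.univ (f i)) and continuous. Let I be a nonempty finite subset of Fin n, let β* minimize β ↦ max_{i ∈ I} f i (β) with optimal value δ_opt, and let I_in ⊆ I be a nonempty subset such that there exists β_in with max_{i ∈ I_in} f i (β_in) < δ_opt. Then there exists an index i ∈ I \ I_in with f i (β*) = δ_opt. -/
/-- For continuous convex residual functions, if a subset `Iin` admits a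
strictly smaller minimax residual than the optimal value `δopt` of the full
minimax problem, then the support set contains an index outside `Iin`. -/
theorem minimax_support_contains_outlier_convex
    (E : Type*) [NormedAddCommGroup E] [NormedSpace ℝ E]
    (n : ℕ) (f : Fin n → E → ℝ)
    (hconv : ∀ i, ConvexOn ℝ Set.univ (f i))
    (hcont : ∀ i, Continuous (f i))
    (I : Finset (Fin n)) (hI : I.Nonempty)
    (βstar : E)
    (hmin : ∀ β, I.sup' hI (fun i => f i βstar) ≤ I.sup' hI (fun i => f i β))
    (δopt : ℝ) (hδ : δopt = I.sup' hI (fun i => f i βstar))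
    (Iin : Finset (Fin n)) (hsub : Iin ⊆ I) (hIin : Iin.Nonempty)
    (βin : E)
    (hin : Iin.sup' hIin (fun i => f i βin) < δopt) :
    ∃ i ∈ I \ Iin, f i βstar = δopt := by
  have hle : ∀ i ∈ I, f i βstar ≤ δopt := fun i hi =>
    hδ ▸ Finset.le_sup' (fun i => f i βstar) hi
  by_contra! hne
  -- Moving from `βstar` slightly towards `βin` makes every residual smaller than `δopt`.
  have hlt : ∀ i ∈ I, ∀ᶠ t : ℝ in nhdsWithin 0 (Set.Ioi 0),
      f i ((1 - t) • βstar + t • βin) < δopt := by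
    intro i hi
    by_cases hmem : i ∈ Iin
    · have hβin : f i βin < δopt := (Finset.sup'_lt_iff hIin).1 hin i hmem
      filter_upwards [Ioc_mem_nhdsGT (zero_lt_one' ℝ)] with t ht
      have hc := (hconv i).2 (Set.mem_univ βstar) (Set.mem_univ βin)
        (sub_nonneg.2 ht.2) ht.1.le (sub_add_cancel 1 t)
      simp only [smul_eq_mul] at hc
      nlinarith [mul_le_mul_of_nonneg_left (hle i hi) (sub_nonneg.2 ht.2),
        mul_lt_mul_of_pos_left hβin ht.1]
    · have hstar : f i βstar < δopt :=
        lt_of_le_of_ne (hle i hi) (hne i (Finset.mem_sdiff.2 ⟨hi, hmem⟩))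
      have hf : Continuous fun t : ℝ => f i ((1 - t) • βstar + t • βin) :=
        (hcont i).comp (by fun_prop)
      exact nhdsWithin_le_nhds (hf.continuousAt.eventually_lt_const (by simpa using hstar))
  obtain ⟨t, ht⟩ := ((Filter.eventually_all_finset I).2 hlt).exists
  exact ((Finset.sup'_lt_iff hI).2 ht).not_ge (hδ ▸ hmin _)
end

section
/- Let d n be natural numbers, let a : Fin n → EuclideanSpace ℝ (Fin d) and y : Fin n → ℝ, and for each i let g i (β) = |⟪a i, β⟫ - y i|. Let I be a nonempty finite subset of Fin n. Then there exists a subset I_s ⊆ I with card I_s ≤ d + 1 such that the infimum over β ∈ EuclideanSpace ℝ (Fin d) of max_{i ∈ I_s} g i (β) equals the infimum over β of max_{i ∈ I} g i (β). -/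
open RealInnerProductSpace

/-- By Helly's theorem applied to strict sublevel sets, the infimum of a finite maximum of convex
functions that are bounded below is already determined by at most `dim E + 1` of them. -/
theorem exists_subset_card_le_iInf_sup'_eq {ι E : Type*} [AddCommGroup E] [Module ℝ E]
    [FiniteDimensional ℝ E] (f : ι → E → ℝ) (s : Finset ι) (hs : s.Nonempty)
    (hconv : ∀ i ∈ s, ConvexOn ℝ Set.univ (f i))
    (hbdd : ∀ i ∈ s, BddBelow (Set.range (f i))) :
    ∃ t ⊆ s, ∃ ht : t.Nonempty, t.card ≤ Module.finrank ℝ E + 1 ∧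
      ⨅ x, t.sup' ht (fun i => f i x) = ⨅ x, s.sup' hs (fun i => f i x) := by
  have bddBelow_sup' (t : Finset ι) (hts : t ⊆ s) (ht : t.Nonempty) :
      BddBelow (Set.range fun x => t.sup' ht (fun i => f i x)) := by
    obtain ⟨i, hi⟩ := ht
    exact (hbdd i (hts hi)).range_mono _ fun x => Finset.le_sup' (fun i => f i x) hi
  set m := ⨅ x, s.sup' hs (fun i => f i x)
  obtain ⟨t, hts, hcard, hempty⟩ : ∃ t ⊆ s, t.card ≤ Module.finrank ℝ E + 1 ∧
      ¬ (⋂ i ∈ t, {x | f i x < m}).Nonempty := by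
    by_contra! hinter
    obtain ⟨x, hx⟩ := Convex.helly_theorem' (𝕜 := ℝ) (F := fun i => {x | f i x < m})
      (fun i hi => by simpa using (hconv i hi).convex_lt m) hinter
    refine (ciInf_le (bddBelow_sup' s subset_rfl hs) x).not_gt ?_
    simpa [Finset.sup'_lt_iff] using hx
  have ht : t.Nonempty := by
    rw [Finset.nonempty_iff_ne_empty]
    rintro rfl
    simp at hempty
  refine ⟨t, hts, ht, hcard, le_antisymm ?_ ?_⟩
  · exact ciInf_mono (bddBelow_sup' t hts ht) fun x => Finset.sup'_mono _ hts ht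
  · refine le_ciInf fun x => not_lt.mp fun hx => hempty ⟨x, ?_⟩
    simpa [Finset.sup'_lt_iff] using hx

/-- The `L∞` minimax problem with absolute residuals over `I` is equivalent
to a sub-problem over a subset `I_s ⊆ I` of at most `d + 1` measurements. -/
theorem linf_subproblem_card_le_abs
    (d n : ℕ) (a : Fin n → EuclideanSpace ℝ (Fin d)) (y : Fin n → ℝ)
    (g : Fin n → EuclideanSpace ℝ (Fin d) → ℝ)
    (hg : ∀ i β, g i β = |⟪a i, β⟫ - y i|)
    (I : Finset (Fin n)) (hI : I.Nonempty) :
    ∃ (Is : Finset (Fin n)) (_ : Is ⊆ I) (hne : Is.Nonempty),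
      Is.card ≤ d + 1 ∧
      (⨅ β : EuclideanSpace ℝ (Fin d), Is.sup' hne (fun i => g i β)) =
        (⨅ β : EuclideanSpace ℝ (Fin d), I.sup' hI (fun i => g i β)) := by
  obtain ⟨Is, hsub, hne, hcard, heq⟩ := exists_subset_card_le_iInf_sup'_eq g I hI
    (fun i _ => by
      refine ⟨convex_univ, fun u _ v _ p q hp hq hpq => ?_⟩
      simp only [hg, inner_add_right, real_inner_smul_right, smul_eq_mul]
      calc |p * ⟪a i, u⟫ + q * ⟪a i, v⟫ - y i|
          = |p * (⟪a i, u⟫ - y i) + q * (⟪a i, v⟫ - y i)| := by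
            congr 1
            linear_combination y i * hpq
        _ ≤ |p * (⟪a i, u⟫ - y i)| + |q * (⟪a i, v⟫ - y i)| := abs_add_le _ _
        _ = p * |⟪a i, u⟫ - y i| + q * |⟪a i, v⟫ - y i| := by
            rw [abs_mul, abs_mul, abs_of_nonneg hp, abs_of_nonneg hq])
    (fun i _ => ⟨0, by rintro _ ⟨β, rfl⟩; rw [hg]; exact abs_nonneg _⟩)
  exact ⟨Is, hsub, hne, by simpa using hcard, heq⟩
end

section
/- Let d n be natural numbers and let f : Fin n → EuclideanSpace ℝ (Fin d) → ℝ be a family of functions such that each f i is nonnegative and convex on all of EuclideanSpace ℝ (Fin d) (ConvexOn ℝ Set.univ (f i)). Let I be a nonempty finite subset of Fin n. Then there exists a subset I_s ⊆ I with card I_s ≤ d + 1 such that the infimum over β of max_{i ∈ I_s} f i (β) equals the infimum over β of max_{i ∈ I} f i (β). -/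
/-- Helly-type statement: for nonnegative convex residual functions on
`EuclideanSpace ℝ (Fin d)`, the minimax value over a nonempty finite index
set `I` is already achieved by a sub-collection of at most `d + 1` of them. -/
theorem minimax_subproblem_card_le_convex
    (d n : ℕ) (f : Fin n → EuclideanSpace ℝ (Fin d) → ℝ)
    (hnonneg : ∀ i β, 0 ≤ f i β)
    (hconv : ∀ i, ConvexOn ℝ Set.univ (f i))
    (I : Finset (Fin n)) (hI : I.Nonempty) :
    ∃ (Is : Finset (Fin n)) (_ : Is ⊆ I) (hne : Is.Nonempty),
      Is.card ≤ d + 1 ∧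
      (⨅ β : EuclideanSpace ℝ (Fin d), Is.sup' hne (fun i => f i β)) =
        (⨅ β : EuclideanSpace ℝ (Fin d), I.sup' hI (fun i => f i β)) := by
  have hbdd (J : Finset (Fin n)) (hJ : J.Nonempty) :
      BddBelow (Set.range fun β : EuclideanSpace ℝ (Fin d) => J.sup' hJ (fun i => f i β)) := by
    refine ⟨0, ?_⟩
    rintro _ ⟨β, rfl⟩
    obtain ⟨j, hj⟩ := hJ
    exact (hnonneg j β).trans (Finset.le_sup' (fun i => f i β) hj)
  by_contra! hne
  set v := ⨅ β : EuclideanSpace ℝ (Fin d), I.sup' hI (fun i => f i β)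
  -- Otherwise Helly's theorem applies to the strict sublevel sets at the minimax value.
  have hinter : (⋂ i ∈ I, {β | f i β < v}).Nonempty := by
    refine Convex.helly_theorem' (𝕜 := ℝ)
      (fun i _ => by simpa using (hconv i).convex_lt v) fun J hJI hcard => ?_
    rw [finrank_euclideanSpace_fin] at hcard
    rcases J.eq_empty_or_nonempty with rfl | hJ
    · simp
    have hle : (⨅ β : EuclideanSpace ℝ (Fin d), J.sup' hJ (fun i => f i β)) ≤ v :=
      ciInf_mono (hbdd J hJ) fun β => Finset.sup'_mono _ hJI hJ
    obtain ⟨β, hβ⟩ := exists_lt_of_ciInf_lt (hle.lt_of_ne (hne J hJI hJ hcard))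
    refine ⟨β, ?_⟩
    simpa [Finset.sup'_lt_iff] using hβ
  obtain ⟨β, hβ⟩ := hinter
  have hlt : I.sup' hI (fun i => f i β) < v := by
    simpa [Finset.sup'_lt_iff] using hβ
  exact (ciInf_le (hbdd I hI) β).not_gt hlt
end

section
/- Let d n be natural numbers, let a : Fin n → EuclideanSpace ℝ (Fin d) and y : Fin n → ℝ, and for each i let f i (β) = (⟪a i, β⟫ - y i)^2. Let I be a nonempty finite subset of Fin n, let β* minimize β ↦ max_{i ∈ I} f i (β) with optimal value δ_opt, let I_supp = {i ∈ I : f i (β*) = δ_opt} be the support set, and suppose I_t = I \ I_supp is nonempty. If β' minimizes β ↦ max_{i ∈ I_t} f i (β), then there exists i ∈ I_supp with f i (β') > max_{j ∈ I_t} f j (β'); that is, it is impossible that all points of the removed support set have residual at β' below the new optimal residual, so not all of the support set can be moved back in the remedy step. -/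
open RealInnerProductSpace

/-- Remedy step soundness (squared residuals): if the support set `Isupp`
is removed and the minimax problem is re-solved on `It = I \ Isupp` with
minimizer `β'`, then some removed index has residual at `β'` strictly above
the new optimal residual; hence not all of the support set is moved back. -/
theorem linf_remedy_not_all_back_sq
    (d n : ℕ) (a : Fin n → EuclideanSpace ℝ (Fin d)) (y : Fin n → ℝ)
    (f : Fin n → EuclideanSpace ℝ (Fin d) → ℝ)
    (hf : ∀ i β, f i β = (⟪a i, β⟫ - y i) ^ 2)
    (I : Finset (Fin n)) (hI : I.Nonempty)
    (βstar : EuclideanSpace ℝ (Fin d))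
    (hmin : ∀ β, I.sup' hI (fun i => f i βstar) ≤ I.sup' hI (fun i => f i β))
    (δopt : ℝ) (hδ : δopt = I.sup' hI (fun i => f i βstar))
    (Isupp It : Finset (Fin n))
    (hIsupp : Isupp = I.filter (fun i => f i βstar = δopt))
    (hIt : It = I \ Isupp) (hne : It.Nonempty)
    (βprime : EuclideanSpace ℝ (Fin d))
    (hmin' : ∀ β, It.sup' hne (fun i => f i βprime) ≤ It.sup' hne (fun i => f i β)) :
    ∃ i ∈ Isupp, It.sup' hne (fun j => f j βprime) < f i βprime := by
  by_contra! h
  have hlt : It.sup' hne (fun j => f j βprime) < δopt := by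
    refine (hmin' βstar).trans_lt ((Finset.sup'_lt_iff hne).2 fun i hi => ?_)
    simp only [hIt, hIsupp, Finset.mem_sdiff, Finset.mem_filter, not_and] at hi
    exact lt_of_le_of_ne (hδ ▸ Finset.le_sup' (fun i => f i βstar) hi.1) (hi.2 hi.1)
  have hle : I.sup' hI (fun i => f i βprime) ≤ It.sup' hne (fun j => f j βprime) := by
    refine Finset.sup'_le hI _ fun i hi => ?_
    by_cases hs : i ∈ Isupp
    · exact h i hs
    · exact Finset.le_sup' (fun j => f j βprime) (hIt ▸ Finset.mem_sdiff.2 ⟨hi, hs⟩)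
  have := hmin βprime
  linarith
end

section
/- Let d n be natural numbers, let a : Fin n → EuclideanSpace ℝ (Fin d) and y : Fin n → ℝ, and for each i let g i (β) = |⟪a i, β⟫ - y i|. Let I be a nonempty finite subset of Fin n, let β* minimize β ↦ max_{i ∈ I} g i (β) with optimal value δ_opt, let I_supp = {i ∈ I : g i (β*) = δ_opt} be the support set, and suppose I_t = I \ I_supp is nonempty. If β' minimizes β ↦ max_{i ∈ I_t} g i (β), then there exists i ∈ I_supp with g i (β') > max_{j ∈ I_t} g j (β'). -/
open RealInnerProductSpace

/-- Remedy step soundness (absolute residuals): if the support set `Isupp`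
is removed and the minimax problem is re-solved on `It = I \ Isupp` with
minimizer `β'`, then some removed index has residual at `β'` strictly above
the new optimal residual; hence not all of the support set is moved back. -/
theorem linf_remedy_not_all_back_abs
    (d n : ℕ) (a : Fin n → EuclideanSpace ℝ (Fin d)) (y : Fin n → ℝ)
    (g : Fin n → EuclideanSpace ℝ (Fin d) → ℝ)
    (hg : ∀ i β, g i β = |⟪a i, β⟫ - y i|)
    (I : Finset (Fin n)) (hI : I.Nonempty)
    (βstar : EuclideanSpace ℝ (Fin d))
    (hmin : ∀ β, I.sup' hI (fun i => g i βstar) ≤ I.sup' hI (fun i => g i β))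
    (δopt : ℝ) (hδ : δopt = I.sup' hI (fun i => g i βstar))
    (Isupp It : Finset (Fin n))
    (hIsupp : Isupp = I.filter (fun i => g i βstar = δopt))
    (hIt : It = I \ Isupp) (hne : It.Nonempty)
    (βprime : EuclideanSpace ℝ (Fin d))
    (hmin' : ∀ β, It.sup' hne (fun i => g i βprime) ≤ It.sup' hne (fun i => g i β)) :
    ∃ i ∈ Isupp, It.sup' hne (fun j => g j βprime) < g i βprime := by
  by_contra! h
  have hlt : It.sup' hne (fun i => g i βstar) < δopt := by
    rw [Finset.sup'_lt_iff]
    intro i hi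
    rw [hIt, hIsupp, Finset.mem_sdiff, Finset.mem_filter] at hi
    have hle : g i βstar ≤ δopt := hδ ▸ Finset.le_sup' (fun i => g i βstar) hi.1
    exact lt_of_le_of_ne hle fun heq => hi.2 ⟨hi.1, heq⟩
  have hle : I.sup' hI (fun i => g i βprime) ≤ It.sup' hne (fun i => g i βprime) := by
    refine Finset.sup'_le _ _ fun i hi => ?_
    by_cases hs : i ∈ Isupp
    · exact h i hs
    · exact Finset.le_sup' (fun i => g i βprime) (hIt ▸ Finset.mem_sdiff.2 ⟨hi, hs⟩)
  linarith [hmin βprime, hmin' βstar]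
end
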